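/- Let T, c, p ∈ (0,∞), δ ∈ (−∞, 1/2 − 1/(2p)), i ∈ {1,2}, and for n ≥ 1 set λ_n = c n^p and σ_n² = λ_n^{2δ−1} · (1/2) · ( T + sin(2 λ_n^{1/2} T)/((−1)^i · 2 λ_n^{1/2}) ). For N ∈ ℕ, N ≥ 1, let γ^N = ⨂_{n≥1} N(0, 𝟙_{{1,…,N}}(n)·σ_n²) and γ = ⨂_{n≥1} N(0, σ_n²) be countable product probability measures on ℝ^ℕ. Then for every N ≥ 1 it holds that ∫ exp(−∑_{n≥1} x_n²) dγ^N(x) − ∫ exp(−∑_{n≥1} x_n²) dγ(x) ≥ ( 1 + inf_{x ∈ [2c^{1/2}T,∞)} sin(x)/((−1)^i x) ) · T c^{2δ−1} 2^{p(2δ−1)} N^{p(2δ−1)+1} / ( (p(1−2δ) − 1) · exp( 6 p(2δ−1) T c^{2δ−1} / (p(2δ−1)+1) ) ) > 0. -/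

import Mathlib

open MeasureTheory ProbabilityTheory
open scoped NNReal

theorem integral_exp_neg_sq_gaussianReal (s : ℝ≥0) :
    ∫ x, Real.exp (-x ^ 2) ∂gaussianReal 0 s = (Real.sqrt (1 + 2 * s))⁻¹ := by
  rcases eq_or_ne s 0 with rfl | hs
  · simp
  have hs' : 0 < (s : ℝ) := by positivity
  have key : ∀ x : ℝ, gaussianPDFReal 0 s x • Real.exp (-x ^ 2)
      = (Real.sqrt (2 * Real.pi * s))⁻¹ * Real.exp (-(1 / (2 * s) + 1) * x ^ 2) := by
    intro x
    rw [gaussianPDFReal_def, smul_eq_mul, mul_assoc, ← Real.exp_add]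
    congr 2
    field_simp
    ring
  rw [integral_gaussianReal_eq_integral_smul hs]
  simp_rw [key]
  rw [integral_const_mul, integral_gaussian, ← Real.sqrt_inv, ← Real.sqrt_mul (by positivity),
    ← Real.sqrt_inv]
  congr 1
  have := Real.pi_pos
  field_simp

theorem lintegral_sq_gaussianReal (s : ℝ≥0) :
    ∫⁻ x, ENNReal.ofReal (x ^ 2) ∂gaussianReal 0 s = s := by
  have h2 : MemLp (fun x : ℝ => x) 2 (gaussianReal 0 s) := memLp_id_gaussianReal 2
  rw [← ofReal_integral_eq_lintegral_ofReal h2.integrable_sq (ae_of_all _ fun x => sq_nonneg x),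
    ← variance_of_integral_eq_zero (X := fun x : ℝ => x) (by fun_prop)
      integral_id_gaussianReal, variance_fun_id_gaussianReal, ENNReal.ofReal_coe_nnreal]

section ProjectiveLimit

variable {ι : Type*} {v : ι → ℝ≥0} {γ : Measure (ι → ℝ)}

theorem ae_summable_sq_of_isProjectiveLimit_gaussian [Countable ι]
    (hv : Summable fun n => (v n : ℝ))
    (hγ : IsProjectiveLimit γ fun J : Finset ι => Measure.pi fun j : J => gaussianReal 0 (v j)) :
    ∀ᵐ x ∂γ, Summable fun n => (x n) ^ 2 := by
  have hcoord (n : ι) : ∫⁻ x, ENNReal.ofReal ((x n) ^ 2) ∂γ = v n := by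
    have h := hγ {n}
    have hm : γ.map (fun x => x n) = gaussianReal 0 (v n) := by
      have : (fun x : ι → ℝ => x n) =
          (fun y : ({n} : Finset ι) → ℝ => y ⟨n, by simp⟩) ∘ Finset.restrict {n} := rfl
      rw [this, ← Measure.map_map (by fun_prop) (by fun_prop), h]
      exact (measurePreserving_eval (fun j : ({n} : Finset ι) => gaussianReal 0 (v j)) _).map_eq
    rw [← lintegral_sq_gaussianReal, ← hm, lintegral_map (by fun_prop) (by fun_prop)]
  have hmeas (n : ι) : Measurable fun x : ι → ℝ => ENNReal.ofReal ((x n) ^ 2) :=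
    ((measurable_pi_apply n).pow_const 2).ennreal_ofReal
  have hfin : ∫⁻ x, ∑' n, ENNReal.ofReal ((x n) ^ 2) ∂γ ≠ ⊤ := by
    rw [lintegral_tsum fun n => (hmeas n).aemeasurable]
    simp_rw [hcoord]
    exact ENNReal.tsum_coe_ne_top_iff_summable.2 (NNReal.summable_coe.1 hv)
  filter_upwards [ae_lt_top (.tsum hmeas) hfin] with x hx
  have := ENNReal.summable_toReal hx.ne
  simpa [ENNReal.toReal_ofReal, sq_nonneg] using this

theorem hasProd_integral_exp_neg_tsum_sq [Countable ι]
    (hv : Summable fun n => (v n : ℝ))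
    (hγ : IsProjectiveLimit γ fun J : Finset ι => Measure.pi fun j : J => gaussianReal 0 (v j)) :
    HasProd (fun n => (Real.sqrt (1 + 2 * v n))⁻¹)
      (∫ x, Real.exp (-∑' n, (x n) ^ 2) ∂γ) := by
  have hfinset (J : Finset ι) : ∫ x, Real.exp (-∑ n ∈ J, (x n) ^ 2) ∂γ =
      ∏ n ∈ J, (Real.sqrt (1 + 2 * v n))⁻¹ := by
    have hcyl : ∀ x : ι → ℝ, Real.exp (-∑ n ∈ J, (x n) ^ 2) =
        (fun y : J → ℝ => ∏ j : J, Real.exp (-(y j) ^ 2)) (J.restrict x) := by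
      intro x
      rw [← Finset.sum_neg_distrib, Real.exp_sum, ← Finset.prod_coe_sort]
      rfl
    rw [integral_congr_ae (ae_of_all _ hcyl),
      ← integral_map (μ := γ) (φ := J.restrict)
        (f := fun y : J → ℝ => ∏ j : J, Real.exp (-(y j) ^ 2))
        (Finset.measurable_restrict J).aemeasurable
        (Continuous.aestronglyMeasurable (by fun_prop)), hγ J,
      integral_fintype_prod_eq_prod (f := fun (_ : J) x => Real.exp (-x ^ 2))]
    simp_rw [integral_exp_neg_sq_gaussianReal]
    exact Finset.prod_coe_sort J fun n => (Real.sqrt (1 + 2 * v n))⁻¹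
  have : IsProbabilityMeasure γ := hγ.isProbabilityMeasure
  simp_rw [HasProd, ← hfinset, SummationFilter.unconditional_filter]
  refine tendsto_integral_filter_of_dominated_convergence (fun _ => 1)
    (.of_forall fun J => Measurable.aestronglyMeasurable (by fun_prop))
    (.of_forall fun J => ae_of_all _ fun x => ?_)
    (integrable_const _) ?_
  · rw [Real.norm_of_nonneg (Real.exp_pos _).le, Real.exp_le_one_iff, neg_nonpos]
    exact Finset.sum_nonneg fun n _ => sq_nonneg _
  · filter_upwards [ae_summable_sq_of_isProjectiveLimit_gaussian hv hγ] with x hx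
    exact (Real.continuous_exp.tendsto _).comp (Filter.Tendsto.neg hx.hasSum)

end ProjectiveLimit

theorem rpow_one_sub_tangent_le {q x y : ℝ} (hq : 1 < q) (hx : 0 < x) (hy : 0 < y) :
    x ^ (1 - q) + (1 - q) * x ^ (-q) * (y - x) ≤ y ^ (1 - q) := by
  have hyx : 0 < y / x := div_pos hy hx
  have h1 : 1 + (1 - q) * (y / x - 1) ≤ (y / x) ^ (1 - q) := by
    rw [Real.rpow_def_of_pos hyx]
    nlinarith [Real.add_one_le_exp (Real.log (y / x) * (1 - q)), Real.log_le_sub_one_of_pos hyx]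
  have h2 : x ^ (1 - q) = x * x ^ (-q) := by
    rw [sub_eq_add_neg, Real.rpow_add hx, Real.rpow_one]
  calc x ^ (1 - q) + (1 - q) * x ^ (-q) * (y - x)
      = x ^ (1 - q) * (1 + (1 - q) * (y / x - 1)) := by rw [h2]; field_simp
    _ ≤ x ^ (1 - q) * (y / x) ^ (1 - q) := by gcongr
    _ = y ^ (1 - q) := by rw [← Real.mul_rpow hx.le hyx.le, mul_div_cancel₀ _ hx.ne']

theorem sum_range_rpow_neg_le {q : ℝ} (hq : 1 < q) (k : ℕ) :
    ∑ n ∈ Finset.range k, ((n + 1 : ℕ) : ℝ) ^ (-q) ≤ q / (q - 1) := by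
  have hq' : 0 < q - 1 := by linarith
  have key : ∀ k : ℕ, (q - 1) * ∑ n ∈ Finset.range (k + 1), ((n + 1 : ℕ) : ℝ) ^ (-q) ≤
      q - ((k + 1 : ℕ) : ℝ) ^ (1 - q) := by
    intro k
    induction k with
    | zero => simp
    | succ k ih =>
      rw [Finset.sum_range_succ, mul_add]
      have := rpow_one_sub_tangent_le (x := ((k + 1 + 1 : ℕ) : ℝ)) (y := ((k + 1 : ℕ) : ℝ)) hq
        (by positivity) (by positivity)
      have e : ((k + 1 : ℕ) : ℝ) - ((k + 1 + 1 : ℕ) : ℝ) = -1 := by push_cast; ring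
      rw [e] at this
      linarith
  rw [le_div_iff₀' hq']
  rcases k with _ | k
  · simp; linarith
  · exact (key k).trans (sub_le_self _ (by positivity))

theorem sub_le_sum_range_rpow_neg {q : ℝ} (hq : 1 < q) (N k : ℕ) :
    ((N + 1 : ℕ) : ℝ) ^ (1 - q) - ((N + 1 + k : ℕ) : ℝ) ^ (1 - q) ≤
      (q - 1) * ∑ j ∈ Finset.range k, ((N + 1 + j : ℕ) : ℝ) ^ (-q) := by
  induction k with
  | zero => simp
  | succ k ih =>
    rw [Finset.sum_range_succ, mul_add]
    have := rpow_one_sub_tangent_le (x := ((N + 1 + k : ℕ) : ℝ))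
      (y := ((N + 1 + (k + 1) : ℕ) : ℝ)) hq (by positivity) (by positivity)
    have e : ((N + 1 + (k + 1) : ℕ) : ℝ) - ((N + 1 + k : ℕ) : ℝ) = 1 := by push_cast; ring
    rw [e] at this
    linarith

theorem summable_posNat_rpow_neg {q : ℝ} (hq : 1 < q) :
    Summable fun n : {n : ℕ // 1 ≤ n} => ((n : ℕ) : ℝ) ^ (-q) :=
  (Real.summable_nat_rpow.2 (by linarith)).subtype _

theorem tsum_posNat_rpow_neg_le {q : ℝ} (hq : 1 < q) :
    ∑' n : {n : ℕ // 1 ≤ n}, ((n : ℕ) : ℝ) ^ (-q) ≤ q / (q - 1) := by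
  let e : ℕ ≃ {n : ℕ // 1 ≤ n} :=
    ⟨fun n => ⟨n + 1, by lia⟩, fun n => n - 1, fun n => by simp, fun n => by
      ext; simp; exact Nat.sub_add_cancel n.2⟩
  rw [← e.tsum_eq]
  exact Real.tsum_le_of_sum_range_le (fun n => by positivity) (sum_range_rpow_neg_le hq)

theorem le_of_hasSum_of_tail_ge {q b S : ℝ} (hq : 1 < q) (hb : 0 ≤ b) {N : ℕ}
    {f : {n : ℕ // 1 ≤ n} → ℝ} (hf : HasSum f S) (h0 : ∀ n, 0 ≤ f n)
    (h : ∀ n : {n : ℕ // 1 ≤ n}, N < n → b * ((n : ℕ) : ℝ) ^ (-q) ≤ f n) :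
    b * ((N + 1 : ℕ) : ℝ) ^ (1 - q) / (q - 1) ≤ S := by
  have hq' : 0 < q - 1 := by linarith
  let g : ℕ ↪ {n : ℕ // 1 ≤ n} := ⟨fun j => ⟨N + 1 + j, by lia⟩, fun j k hjk => by
    simpa using hjk⟩
  have hpart (k : ℕ) : b * (((N + 1 : ℕ) : ℝ) ^ (1 - q) - ((N + 1 + k : ℕ) : ℝ) ^ (1 - q))
      ≤ (q - 1) * S := by
    calc _ ≤ b * ((q - 1) * ∑ j ∈ Finset.range k, ((N + 1 + j : ℕ) : ℝ) ^ (-q)) := by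
          gcongr; exact sub_le_sum_range_rpow_neg hq N k
      _ = (q - 1) * ∑ j ∈ Finset.range k, b * ((N + 1 + j : ℕ) : ℝ) ^ (-q) := by
          rw [← Finset.mul_sum]; ring
      _ ≤ (q - 1) * ∑ j ∈ Finset.range k, f (g j) := by
          gcongr with j; exact h (g j) (show N < N + 1 + j by lia)
      _ ≤ (q - 1) * S := by
          rw [← Finset.sum_map]
          gcongr
          exact sum_le_hasSum _ (fun n _ => h0 n) hf
  have hlim : Filter.Tendsto (fun k : ℕ => ((N + 1 + k : ℕ) : ℝ) ^ (1 - q)) .atTop (nhds 0) := by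
    have := (tendsto_rpow_neg_atTop hq').comp (tendsto_natCast_atTop_atTop (R := ℝ))
    simpa [Function.comp_def, add_comm] using (Filter.tendsto_add_atTop_iff_nat (N + 1)).2 this
  have := le_of_tendsto' ((tendsto_const_nhds.sub hlim).const_mul b) hpart
  rw [div_le_iff₀ hq']
  linarith

theorem exp_neg_half_log {s : ℝ} (hs : 0 ≤ s) :
    Real.exp (-(Real.log (1 + 2 * s) / 2)) = (Real.sqrt (1 + 2 * s))⁻¹ := by
  rw [Real.exp_neg, Real.sqrt_eq_rpow, Real.rpow_def_of_pos (by linarith)]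
  congr 2; ring

theorem half_log_le {s : ℝ} (hs : 0 ≤ s) : Real.log (1 + 2 * s) / 2 ≤ s := by
  linarith [Real.log_le_sub_one_of_pos (x := 1 + 2 * s) (by linarith)]

theorem div_le_half_log {s a : ℝ} (hs : 0 ≤ s) (hsa : s ≤ a) :
    s / (1 + 2 * a) ≤ Real.log (1 + 2 * s) / 2 := by
  have h1 := Real.one_sub_inv_le_log_of_pos (x := 1 + 2 * s) (by linarith)
  have h2 : 1 - (1 + 2 * s)⁻¹ = 2 * (s / (1 + 2 * s)) := by field_simp; ring
  have h3 : s / (1 + 2 * a) ≤ s / (1 + 2 * s) := by gcongr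
  linarith

/-- Comparison of a product of Gaussian Laplace transforms with its truncation when the variances
decay like `n ^ (-q)`. -/
theorem truncated_prod_sub_prod_ge {q a m : ℝ} (hq : 1 < q) (ha : 0 ≤ a) (hm : 0 ≤ m) {N : ℕ}
    (hN : 1 ≤ N) {s : {n : ℕ // 1 ≤ n} → ℝ}
    (hsa : ∀ n : {n : ℕ // 1 ≤ n}, s n ≤ a * ((n : ℕ) : ℝ) ^ (-q))
    (hms : ∀ n : {n : ℕ // 1 ≤ n}, m * a / 2 * ((n : ℕ) : ℝ) ^ (-q) ≤ s n) {PN P : ℝ}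
    (hPN : HasProd (fun n : {n : ℕ // 1 ≤ n} =>
      (Real.sqrt (1 + 2 * if n.1 ≤ N then s n else 0))⁻¹) PN)
    (hP : HasProd (fun n => (Real.sqrt (1 + 2 * s n))⁻¹) P) :
    m * a * 2 ^ (-q) * (N : ℝ) ^ (1 - q) / (q - 1) * Real.exp (-(6 * q * a / (q - 1))) ≤
      PN - P := by
  have hq' : 0 < q - 1 := by linarith
  have hs0 (n) : 0 ≤ s n := le_trans (by positivity) (hms n)
  have hle (n : {n : ℕ // 1 ≤ n}) : s n ≤ a := by
    refine (hsa n).trans (mul_le_of_le_one_right ha ?_)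
    exact Real.rpow_le_one_of_one_le_of_nonpos (by exact_mod_cast n.2) (by linarith)
  set sN : {n : ℕ // 1 ≤ n} → ℝ := fun n => if (n : ℕ) ≤ N then s n else 0 with hsN
  have hsN0 (n) : 0 ≤ sN n := by simp only [hsN]; split_ifs <;> simp [hs0]
  have hsNs (n) : sN n ≤ s n := by simp only [hsN]; split_ifs <;> simp [hs0]
  have hsum := (summable_posNat_rpow_neg hq).mul_left a
  have hsums : Summable s := hsum.of_nonneg_of_le hs0 hsa
  have hL : Summable fun n => Real.log (1 + 2 * s n) / 2 :=
    hsums.of_nonneg_of_le (fun n => div_nonneg (Real.log_nonneg (by linarith [hs0 n])) two_pos.le)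
      fun n => half_log_le (hs0 n)
  have hLN : Summable fun n => Real.log (1 + 2 * sN n) / 2 :=
    hsums.of_nonneg_of_le (fun n => div_nonneg (Real.log_nonneg (by linarith [hsN0 n])) two_pos.le)
      fun n => (half_log_le (hsN0 n)).trans (hsNs n)
  obtain ⟨G, hG⟩ := hL
  obtain ⟨GN, hGN⟩ := hLN
  have hPG : P = Real.exp (-G) := by
    refine hP.unique ?_
    simpa only [Function.comp_def, exp_neg_half_log (hs0 _)] using hG.neg.rexp
  have hPGN : PN = Real.exp (-GN) := by
    refine hPN.unique ?_
    simpa only [Function.comp_def, exp_neg_half_log (hsN0 _)] using hGN.neg.rexp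
  have hGle : G ≤ a * (q / (q - 1)) := by
    calc G ≤ ∑' n : {n : ℕ // 1 ≤ n}, a * ((n : ℕ) : ℝ) ^ (-q) :=
          hasSum_le (fun n => (half_log_le (hs0 n)).trans (hsa n)) hG hsum.hasSum
      _ ≤ _ := by rw [tsum_mul_left]; gcongr; exact tsum_posNat_rpow_neg_le hq
  have hgap : m * a / 2 / (1 + 2 * a) * ((N + 1 : ℕ) : ℝ) ^ (1 - q) / (q - 1) ≤ G - GN := by
    refine le_of_hasSum_of_tail_ge hq (by positivity) (hG.sub hGN) (fun n => ?_) fun n hn => ?_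
    · have := Real.log_le_log (by linarith [hsN0 n]) (by linarith [hsNs n] :
        1 + 2 * sN n ≤ 1 + 2 * s n)
      linarith
    · have h1 : sN n = 0 := if_neg hn.not_ge
      rw [h1]
      have h2 := div_le_half_log (hs0 n) (hle n)
      have h3 : m * a / 2 / (1 + 2 * a) * ((n : ℕ) : ℝ) ^ (-q) ≤ s n / (1 + 2 * a) := by
        rw [div_mul_eq_mul_div]; gcongr; exact hms n
      simp
      linarith
  have hpow : 2 * (2 ^ (-q) * (N : ℝ) ^ (1 - q)) ≤ ((N + 1 : ℕ) : ℝ) ^ (1 - q) := by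
    have hN' : (1 : ℝ) ≤ N := by exact_mod_cast hN
    have h2 : (2 : ℝ) ^ (1 - q) = 2 * 2 ^ (-q) := by
      rw [sub_eq_add_neg, Real.rpow_add two_pos, Real.rpow_one]
    rw [← mul_assoc, ← h2, ← Real.mul_rpow two_pos.le (by positivity)]
    exact Real.rpow_le_rpow_of_nonpos (by positivity) (by push_cast; linarith) (by linarith)
  have hq1 : 1 ≤ q / (q - 1) := by rw [le_div_iff₀ hq']; linarith
  have hexp : Real.exp (-(2 * a * (q / (q - 1)))) ≤ 1 / (1 + 2 * a) := by
    rw [Real.exp_neg, ← one_div]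
    gcongr
    nlinarith [Real.add_one_le_exp (2 * a * (q / (q - 1)))]
  calc m * a * 2 ^ (-q) * (N : ℝ) ^ (1 - q) / (q - 1) * Real.exp (-(6 * q * a / (q - 1)))
      ≤ m * a * 2 ^ (-q) * (N : ℝ) ^ (1 - q) / (q - 1) *
        (Real.exp (-(2 * a * (q / (q - 1)))) * Real.exp (-(a * (q / (q - 1))))) := by
        rw [← Real.exp_add]
        gcongr
        have : 0 ≤ a * (q / (q - 1)) := by positivity
        have e : 6 * q * a / (q - 1) = 6 * (a * (q / (q - 1))) := by ring
        linarith
    _ ≤ m * a * 2 ^ (-q) * (N : ℝ) ^ (1 - q) / (q - 1) * (1 / (1 + 2 * a) * Real.exp (-G)) := by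
        gcongr
    _ = m * a / 2 / (1 + 2 * a) * (2 * (2 ^ (-q) * (N : ℝ) ^ (1 - q))) / (q - 1) *
        Real.exp (-G) := by ring
    _ ≤ m * a / 2 / (1 + 2 * a) * ((N + 1 : ℕ) : ℝ) ^ (1 - q) / (q - 1) * Real.exp (-G) := by
        gcongr
    _ ≤ (G - GN) * Real.exp (-G) := by gcongr
    _ ≤ (Real.exp (G - GN) - 1) * Real.exp (-G) := by
        refine mul_le_mul_of_nonneg_right ?_ (Real.exp_pos _).le
        linarith [Real.add_one_le_exp (G - GN)]
    _ = PN - P := by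
        rw [hPG, hPGN, sub_mul, ← Real.exp_add, one_mul]; ring_nf

theorem bddBelow_range_sin_div (σ x₀ : ℝ) (hσ : |σ| = 1) :
    BddBelow (Set.range fun x : Set.Ici x₀ => Real.sin x / (σ * (x : ℝ))) := by
  refine ⟨-1, ?_⟩
  rintro _ ⟨x, rfl⟩
  refine (abs_le.1 ?_).1
  rw [abs_div, abs_mul, hσ, one_mul]
  exact div_le_one_of_le₀ Real.abs_sin_le_abs (abs_nonneg _)

theorem neg_one_lt_iInf_sin_div {σ x₀ : ℝ} (hσ : |σ| = 1) (hx₀ : 0 < x₀) :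
    -1 < ⨅ x : Set.Ici x₀, Real.sin x / (σ * (x : ℝ)) := by
  have hcont : ContinuousOn (fun x : ℝ => |Real.sin x| / x) (Set.Icc x₀ (max x₀ 2)) :=
    Real.continuous_sin.abs.continuousOn.div continuousOn_id fun x hx => (hx₀.trans_le hx.1).ne'
  obtain ⟨y, hy, hmax⟩ := isCompact_Icc.exists_isMaxOn
    ⟨x₀, le_refl x₀, le_max_left _ _⟩ hcont
  have hy0 : 0 < y := hx₀.trans_le hy.1
  have hylt : |Real.sin y| / y < 1 := by
    rw [div_lt_one hy0]
    simpa [abs_of_pos hy0] using Real.abs_sin_lt_abs hy0.ne'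
  have hbound (x : Set.Ici x₀) : |Real.sin x| / x ≤ max (|Real.sin y| / y) (1 / 2) := by
    rcases le_total (x : ℝ) (max x₀ 2) with h | h
    · exact (hmax ⟨x.2, h⟩).trans (le_max_left _ _)
    · refine le_trans ?_ (le_max_right _ _)
      have : (2 : ℝ) ≤ x := (le_max_right _ _).trans h
      gcongr
      exact Real.abs_sin_le_one _
  have : Nonempty (Set.Ici x₀) := ⟨⟨x₀, le_refl x₀⟩⟩
  refine lt_of_lt_of_le (b := -max (|Real.sin y| / y) (1 / 2)) ?_ (le_ciInf fun x => ?_)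
  · rw [neg_lt_neg_iff]; exact max_lt hylt (by norm_num)
  · have hx : 0 < (x : ℝ) := hx₀.trans_le x.2
    have h : |Real.sin x / (σ * (x : ℝ))| = |Real.sin x| / x := by
      rw [abs_div, abs_mul, hσ, one_mul, abs_of_pos hx]
    exact (abs_le.1 (h.le.trans (hbound x))).1

/-- Corollary 2.10 (Gaussian reformulation), the paper's main lower bound: for
`T, c, p ∈ (0,∞)`, `δ < 1/2 - 1/(2p)`, `i ∈ {1,2}`, `λ_n = c n^p`,
`σ_n² = λ_n^{2δ-1} (1/2)(T + sin(2√λ_n T)/((-1)^i 2√λ_n))` for `n ≥ 1`, and the countable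
product probability measures `γ^N = ⨂_{n≥1} N(0, 𝟙_{{1,…,N}}(n) σ_n²)` and
`γ = ⨂_{n≥1} N(0, σ_n²)` on `ℝ^ℕ` (characterized as projective limits of the finite product
Gaussian measures), it holds for every `N ≥ 1` that
`∫ exp(-∑_{n≥1} x_n²) dγ^N - ∫ exp(-∑_{n≥1} x_n²) dγ
  ≥ (1 + inf_{x ∈ [2√c T,∞)} sin x/((-1)^i x)) T c^{2δ-1} 2^{p(2δ-1)} N^{p(2δ-1)+1}
      / ((p(1-2δ) - 1) exp(6p(2δ-1)Tc^{2δ-1}/(p(2δ-1)+1))) > 0`. -/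
theorem stmt_14 (T c p δ : ℝ) (hT : 0 < T) (hc : 0 < c) (hp : 0 < p)
    (hδ : δ < 1 / 2 - 1 / (2 * p)) (i : ℕ) (hi : i = 1 ∨ i = 2)
    (v : {n : ℕ // 1 ≤ n} → ℝ≥0)
    (hv : ∀ n : {n : ℕ // 1 ≤ n}, (v n : ℝ) =
      (c * ((n : ℕ) : ℝ) ^ p) ^ (2 * δ - 1) * (1 / 2) *
        (T + Real.sin (2 * Real.sqrt (c * ((n : ℕ) : ℝ) ^ p) * T) /
          ((-1 : ℝ) ^ i * 2 * Real.sqrt (c * ((n : ℕ) : ℝ) ^ p))))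
    (N : ℕ) (hN : 1 ≤ N) (γN γ : Measure ({n : ℕ // 1 ≤ n} → ℝ))
    (hγN : IsProjectiveLimit γN fun J : Finset {n : ℕ // 1 ≤ n} =>
      Measure.pi fun j : J => gaussianReal 0 (if ((j : {n : ℕ // 1 ≤ n}) : ℕ) ≤ N then
        v (j : {n : ℕ // 1 ≤ n}) else 0))
    (hγ : IsProjectiveLimit γ fun J : Finset {n : ℕ // 1 ≤ n} =>
      Measure.pi fun j : J => gaussianReal 0 (v (j : {n : ℕ // 1 ≤ n}))) :
    (∫ x, Real.exp (-∑' n, (x n) ^ 2) ∂γN) - ∫ x, Real.exp (-∑' n, (x n) ^ 2) ∂γ ≥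
      (1 + ⨅ x : (Set.Ici (2 * Real.sqrt c * T)), Real.sin x / ((-1 : ℝ) ^ i * (x : ℝ))) *
        T * c ^ (2 * δ - 1) * (2 : ℝ) ^ (p * (2 * δ - 1)) * (N : ℝ) ^ (p * (2 * δ - 1) + 1) /
        ((p * (1 - 2 * δ) - 1) *
          Real.exp (6 * p * (2 * δ - 1) * T * c ^ (2 * δ - 1) / (p * (2 * δ - 1) + 1))) ∧
    0 < (1 + ⨅ x : (Set.Ici (2 * Real.sqrt c * T)), Real.sin x / ((-1 : ℝ) ^ i * (x : ℝ))) *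
        T * c ^ (2 * δ - 1) * (2 : ℝ) ^ (p * (2 * δ - 1)) * (N : ℝ) ^ (p * (2 * δ - 1) + 1) /
        ((p * (1 - 2 * δ) - 1) *
          Real.exp (6 * p * (2 * δ - 1) * T * c ^ (2 * δ - 1) / (p * (2 * δ - 1) + 1))) := by
  set σ : ℝ := (-1 : ℝ) ^ i with hσdef
  have hσ : |σ| = 1 := by simp [hσdef]
  have hsc : 0 < Real.sqrt c := Real.sqrt_pos.2 hc
  set q : ℝ := p * (1 - 2 * δ) with hq_def
  have hq : 1 < q := by
    have h : 1 / (2 * p) * (2 * p) = 1 := by field_simp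
    have := mul_lt_mul_of_pos_right hδ (by positivity : 0 < 2 * p)
    rw [hq_def]
    linarith
  have hq' : 0 < q - 1 := by linarith
  have hI := neg_one_lt_iInf_sin_div hσ (by positivity : 0 < 2 * Real.sqrt c * T)
  set I : ℝ := ⨅ x : (Set.Ici (2 * Real.sqrt c * T)), Real.sin x / (σ * (x : ℝ))
  set a : ℝ := T * c ^ (2 * δ - 1) with ha_def
  have ha : 0 < a := by positivity
  have hv' (n : {n : ℕ // 1 ≤ n}) : ∃ y : Set.Ici (2 * Real.sqrt c * T),
      (v n : ℝ) = a * ((n : ℕ) : ℝ) ^ (-q) * ((1 + Real.sin y / (σ * (y : ℝ))) / 2) := by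
    have hn : (1 : ℝ) ≤ ((n : ℕ) : ℝ) := by exact_mod_cast n.2
    have hr : Real.sqrt c ≤ Real.sqrt (c * ((n : ℕ) : ℝ) ^ p) :=
      Real.sqrt_le_sqrt (le_mul_of_one_le_right hc.le (Real.one_le_rpow hn hp.le))
    refine ⟨⟨2 * Real.sqrt (c * ((n : ℕ) : ℝ) ^ p) * T,
      show 2 * Real.sqrt c * T ≤ 2 * Real.sqrt (c * ((n : ℕ) : ℝ) ^ p) * T by gcongr⟩, ?_⟩
    have hpow : (c * ((n : ℕ) : ℝ) ^ p) ^ (2 * δ - 1) =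
        c ^ (2 * δ - 1) * ((n : ℕ) : ℝ) ^ (-q) := by
      rw [Real.mul_rpow hc.le (by positivity), ← Real.rpow_mul (by positivity)]
      congr 2
      rw [hq_def]; ring
    have hr0 : Real.sqrt (c * ((n : ℕ) : ℝ) ^ p) ≠ 0 := (hsc.trans_le hr).ne'
    have hσ0 : σ ≠ 0 := fun h => by simp [h] at hσ
    rw [hv, hpow, ha_def]
    field_simp
  have hsa (n : {n : ℕ // 1 ≤ n}) : (v n : ℝ) ≤ a * ((n : ℕ) : ℝ) ^ (-q) := by
    obtain ⟨y, hy⟩ := hv' n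
    rw [hy]
    refine mul_le_of_le_one_right (by positivity) ?_
    have : Real.sin y / (σ * (y : ℝ)) ≤ 1 := by
      refine (le_abs_self _).trans ?_
      rw [abs_div, abs_mul, hσ, one_mul]
      exact div_le_one_of_le₀ Real.abs_sin_le_abs (abs_nonneg _)
    linarith
  have hms (n : {n : ℕ // 1 ≤ n}) : (1 + I) * a / 2 * ((n : ℕ) : ℝ) ^ (-q) ≤ v n := by
    obtain ⟨y, hy⟩ := hv' n
    have hIy : I ≤ Real.sin y / (σ * (y : ℝ)) := ciInf_le (bddBelow_range_sin_div σ _ hσ) y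
    calc (1 + I) * a / 2 * ((n : ℕ) : ℝ) ^ (-q)
        = a * ((n : ℕ) : ℝ) ^ (-q) * ((1 + I) / 2) := by ring
      _ ≤ v n := by rw [hy]; gcongr
  have hsum : Summable fun n => (v n : ℝ) :=
    ((summable_posNat_rpow_neg hq).mul_left a).of_nonneg_of_le (fun n => (v n).2) hsa
  have hsumN : Summable fun n : {n : ℕ // 1 ≤ n} =>
      ((if (n : ℕ) ≤ N then v n else 0 : ℝ≥0) : ℝ) :=
    hsum.of_nonneg_of_le (fun n => NNReal.coe_nonneg _) fun n => by split_ifs <;> simp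
  have hP := hasProd_integral_exp_neg_tsum_sq hsum hγ
  have hPN := hasProd_integral_exp_neg_tsum_sq
    (v := fun n : {n : ℕ // 1 ≤ n} => if (n : ℕ) ≤ N then v n else 0) hsumN hγN
  simp only [apply_ite NNReal.toReal, NNReal.coe_zero] at hPN
  have hmain := truncated_prod_sub_prod_ge hq ha.le (by linarith : 0 ≤ 1 + I) hN hsa hms hPN hP
  have exponent_eq : p * (2 * δ - 1) = -q := by rw [hq_def]; ring
  have exp_arg_eq : 6 * p * (2 * δ - 1) * T * c ^ (2 * δ - 1) / (-q + 1) = 6 * q * a / (q - 1) := by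
    rw [show -q + 1 = -(q - 1) by ring, div_neg, ← neg_div, ha_def, hq_def]
    congr 1
    ring
  have bound_eq : (1 + I) * T * c ^ (2 * δ - 1) * (2 : ℝ) ^ (-q) * (N : ℝ) ^ (-q + 1) /
      ((q - 1) * Real.exp (6 * q * a / (q - 1))) =
      (1 + I) * a * 2 ^ (-q) * (N : ℝ) ^ (1 - q) / (q - 1) *
        Real.exp (-(6 * q * a / (q - 1))) := by
    rw [Real.exp_neg, neg_add_eq_sub, ha_def]
    field_simp
  have hN0 : (0 : ℝ) < N := by exact_mod_cast hN
  have hI1 : 0 < 1 + I := by linarith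
  rw [exponent_eq, exp_arg_eq, bound_eq]
  exact ⟨hmain, by positivity⟩
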